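/- The Ehrhart counting function of B_3^2 satisfies L(B_3^2; t) = #(tB_3^2 ∩ Z^{3×3}) = (1/12)t^4 + (1/2)t^3 + (17/12)t^2 + 2t + 1 = 2·binomial(t+3, 4) + binomial(t+2, 2) for all integers t ≥ 1. -/

import Mathlib

open scoped BigOperators

/-- A monotone lattice path in the `n × n` grid from `(0,0)` to `(n-1,n-1)` (0-indexed). -/
def IsLatticePath (n : ℕ) (p : ℕ → ℕ × ℕ) : Prop :=
  p 0 = (0, 0) ∧ p (2 * n - 2) = (n - 1, n - 1) ∧
    ∀ i, i < 2 * n - 2 →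
      p (i + 1) = ((p i).1 + 1, (p i).2) ∨ p (i + 1) = ((p i).1, (p i).2 + 1)

/-- Entry of a matrix at a ℕ-indexed position (0 outside the index range). -/
def ent {n : ℕ} (X : Matrix (Fin n) (Fin n) ℝ) (q : ℕ × ℕ) : ℝ :=
  if h : q.1 < n ∧ q.2 < n then X ⟨q.1, h.1⟩ ⟨q.2, h.2⟩ else 0

/-- Sum of matrix entries along a lattice path. -/
def pathSum {n : ℕ} (X : Matrix (Fin n) (Fin n) ℝ) (p : ℕ → ℕ × ℕ) : ℝ :=
  ∑ i ∈ Finset.range (2 * n - 1), ent X (p i)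

/-- Membership in the restricted Birkhoff polytope `B_n^k`. -/
def InRestrictedBirkhoff (n k : ℕ) (X : Matrix (Fin n) (Fin n) ℝ) : Prop :=
  (∀ i j, 0 ≤ X i j) ∧ (∀ i, ∑ j, X i j = 1) ∧ (∀ j, ∑ i, X i j = 1) ∧
    ∀ p : ℕ → ℕ × ℕ, IsLatticePath n p → pathSum X p ≤ k

/-- A real matrix with all entries integers. -/
def IsIntegerMatrix {n : ℕ} (X : Matrix (Fin n) (Fin n) ℝ) : Prop :=
  ∀ i j, ∃ m : ℤ, X i j = (m : ℝ)

lemma ncard_nat_tuples_sum_eq (k n : ℕ) :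
    {v : Fin k → ℕ | ∑ i, v i = n}.ncard = Nat.multichoose k n := by
  rw [← Nat.card_coe_set_eq, Set.coe_ofPred,
    ← Nat.card_congr (Sym.equivNatSumOfFintype (Fin k) n), Nat.card_eq_fintype_card,
    Sym.card_sym_eq_multichoose, Fintype.card_fin]

lemma forall_pathSum_le_iff (X : Matrix (Fin 3) (Fin 3) ℝ) (c : ℝ) :
    (∀ p, IsLatticePath 3 p → pathSum X p ≤ c) ↔
      X 0 0 + X 0 1 + X 0 2 + X 1 2 + X 2 2 ≤ c ∧
      X 0 0 + X 0 1 + X 1 1 + X 1 2 + X 2 2 ≤ c ∧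
      X 0 0 + X 0 1 + X 1 1 + X 2 1 + X 2 2 ≤ c ∧
      X 0 0 + X 1 0 + X 1 1 + X 1 2 + X 2 2 ≤ c ∧
      X 0 0 + X 1 0 + X 1 1 + X 2 1 + X 2 2 ≤ c ∧
      X 0 0 + X 1 0 + X 2 0 + X 2 1 + X 2 2 ≤ c := by
  constructor
  · intro h
    have path (a b d : ℕ × ℕ)
        (hp : IsLatticePath 3 fun i ↦ [(0, 0), a, b, d, (2, 2)].getD i (0, 0)) :
        ent X (0, 0) + ent X a + ent X b + ent X d + ent X (2, 2) ≤ c := by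
      simpa [pathSum, Finset.sum_range_succ] using h _ hp
    have valid (a b d : ℕ × ℕ)
        (h₀ : a = (1, 0) ∨ a = (0, 1))
        (h₁ : b = (a.1 + 1, a.2) ∨ b = (a.1, a.2 + 1))
        (h₂ : d = (b.1 + 1, b.2) ∨ d = (b.1, b.2 + 1))
        (h₃ : (2, 2) = (d.1 + 1, d.2) ∨ (2, 2) = (d.1, d.2 + 1)) :
        IsLatticePath 3 fun i ↦ [(0, 0), a, b, d, (2, 2)].getD i (0, 0) := by
      refine ⟨rfl, rfl, fun i hi ↦ ?_⟩
      interval_cases i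
      exacts [by simpa using h₀, h₁, h₂, h₃]
    refine ⟨?_, ?_, ?_, ?_, ?_, ?_⟩
    · exact path (0, 1) (0, 2) (1, 2) (valid _ _ _ (by simp) (by simp) (by simp) (by simp))
    · exact path (0, 1) (1, 1) (1, 2) (valid _ _ _ (by simp) (by simp) (by simp) (by simp))
    · exact path (0, 1) (1, 1) (2, 1) (valid _ _ _ (by simp) (by simp) (by simp) (by simp))
    · exact path (1, 0) (1, 1) (1, 2) (valid _ _ _ (by simp) (by simp) (by simp) (by simp))
    · exact path (1, 0) (1, 1) (2, 1) (valid _ _ _ (by simp) (by simp) (by simp) (by simp))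
    · exact path (1, 0) (2, 0) (2, 1) (valid _ _ _ (by simp) (by simp) (by simp) (by simp))
  · rintro h p ⟨h₀, h₄, hs⟩
    have s₀ := hs 0 (by norm_num)
    have s₁ := hs 1 (by norm_num)
    have s₂ := hs 2 (by norm_num)
    have s₃ := hs 3 (by norm_num)
    simp only [Nat.reduceAdd, Nat.reduceMul, Nat.reduceSub] at h₄ s₀ s₁ s₂ s₃
    rw [h₀] at s₀
    rw [h₄] at s₃
    simp only [pathSum, Nat.reduceMul, Nat.reduceSub, Finset.sum_range_succ, Finset.sum_range_zero,
      zero_add, h₀, h₄]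
    rcases s₀ with e₁ | e₁ <;> rw [e₁] at s₁ ⊢ <;>
    rcases s₁ with e₂ | e₂ <;> rw [e₂] at s₂ ⊢ <;>
    rcases s₂ with e₃ | e₃ <;> rw [e₃] at s₃ ⊢ <;>
    simp at s₃ <;> simp [ent] <;> linarith

/-- The integer combination of the five nonidentity `3 × 3` permutation matrices with the given
coefficients. -/
def permCombination (w : Fin 5 → ℤ) : Matrix (Fin 3) (Fin 3) ℝ :=
  Matrix.map !![w 2, w 1 + w 3, w 0 + w 4; w 1 + w 4, w 0, w 2 + w 3; w 0 + w 3, w 2 + w 4, w 1]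
    Int.cast

lemma permCombination_injective : Function.Injective permCombination := by
  intro v w h
  have entry (i j : Fin 3) : permCombination v i j = permCombination w i j := by rw [h]
  have h₀ := entry 1 1
  have h₁ := entry 2 2
  have h₂ := entry 0 0
  have h₃ := entry 0 1
  have h₄ := entry 1 0
  simp only [permCombination, Matrix.map_apply, Int.cast_inj] at h₀ h₁ h₂ h₃ h₄
  simp at h₀ h₁ h₂ h₃ h₄
  funext i
  fin_cases i <;> simp <;> omega

/-- The coefficients for which `permCombination` lies in the `t`-th dilate of `B_3^2`. -/
def dilateCoeffs (t : ℕ) : Set (Fin 5 → ℤ) :=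
  {w | w 0 + w 1 + w 2 + w 3 + w 4 = t ∧ 0 ≤ w 1 ∧ 0 ≤ w 2 ∧
    0 ≤ w 0 + 2 * w 3 ∧ 0 ≤ w 0 + 2 * w 4 ∧
    0 ≤ w 1 + w 3 ∧ 0 ≤ w 1 + w 4 ∧ 0 ≤ w 2 + w 3 ∧ 0 ≤ w 2 + w 4 ∧ 0 ≤ w 0}

lemma inRestrictedBirkhoff_inv_smul_iff {n k t : ℕ} (ht : 1 ≤ t) (Z : Matrix (Fin n) (Fin n) ℝ) :
    InRestrictedBirkhoff n k ((t : ℝ)⁻¹ • Z) ↔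
      (∀ i j, 0 ≤ Z i j) ∧ (∀ i, ∑ j, Z i j = t) ∧ (∀ j, ∑ i, Z i j = t) ∧
        ∀ p, IsLatticePath n p → pathSum Z p ≤ k * t := by
  have ht' : (0 : ℝ) < t := by exact_mod_cast ht
  have hent (q : ℕ × ℕ) : ent ((t : ℝ)⁻¹ • Z) q = (t : ℝ)⁻¹ * ent Z q := by
    unfold ent
    split_ifs <;> simp
  simp only [InRestrictedBirkhoff, pathSum, hent, ← Finset.mul_sum, Matrix.smul_apply, smul_eq_mul,
    inv_mul_eq_one₀ ht'.ne', inv_mul_le_iff₀ ht', mul_nonneg_iff_of_pos_left (inv_pos.2 ht'),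
    mul_comm (t : ℝ) k, eq_comm (a := (t : ℝ))]

lemma dilate_eq_image {t : ℕ} (ht : 1 ≤ t) :
    {Z : Matrix (Fin 3) (Fin 3) ℝ | IsIntegerMatrix Z ∧
        ∃ X, InRestrictedBirkhoff 3 2 X ∧ Z = (t : ℝ) • X} =
      permCombination '' dilateCoeffs t := by
  have ht' : (t : ℝ) ≠ 0 := by exact_mod_cast (by omega : t ≠ 0)
  have hdil (Z : Matrix (Fin 3) (Fin 3) ℝ) :
      (∃ X, InRestrictedBirkhoff 3 2 X ∧ Z = (t : ℝ) • X) ↔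
        InRestrictedBirkhoff 3 2 ((t : ℝ)⁻¹ • Z) := by
    constructor
    · rintro ⟨X, hX, rfl⟩
      rwa [inv_smul_smul₀ ht']
    · exact fun h ↦ ⟨_, h, (smul_inv_smul₀ ht' Z).symm⟩
  ext Z
  simp only [Set.mem_ofPred_eq, hdil, inRestrictedBirkhoff_inv_smul_iff ht, forall_pathSum_le_iff,
    Fin.forall_fin_succ, Fin.sum_univ_three, Set.mem_image]
  constructor
  · rintro ⟨hZ, h⟩
    choose m hm using hZ
    have hZ : Z = fun i j ↦ (m i j : ℝ) := by
      ext i j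
      exact hm i j
    subst hZ
    simp at h
    norm_cast at h
    refine ⟨![m 1 1, m 2 2, m 0 0, m 0 1 - m 2 2, m 1 0 - m 2 2], ?_, ?_⟩
    · simp [dilateCoeffs]
      omega
    · ext i j
      fin_cases i <;> fin_cases j <;> simp [permCombination] <;> norm_cast <;> omega
  · rintro ⟨w, hw, rfl⟩
    refine ⟨fun i j ↦ ⟨_, rfl⟩, ?_⟩
    simp only [dilateCoeffs, Set.mem_ofPred_eq] at hw
    simp [permCombination]
    norm_cast
    omega

/-- Nonnegative coefficients, as integers. -/
def natCoeffs (v : Fin 5 → ℕ) : Fin 5 → ℤ := fun i ↦ v i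

/-- Coefficients of which the smaller of the last two is negative: it is the negative of
`min (v 3) (v 4) + 1`. -/
def negCoeffs (v : Fin 5 → ℕ) : Fin 5 → ℤ :=
  let k : ℤ := min (v 3 : ℤ) (v 4) + 1
  ![v 0 + 2 * k, v 1 + k, v 2 + k, v 3 + 1 - 2 * k, v 4 + 1 - 2 * k]

lemma natCoeffs_injective : Function.Injective natCoeffs :=
  Nat.cast_injective.comp_left

lemma negCoeffs_injective : Function.Injective negCoeffs := by
  intro v w h
  have h₀ := congrFun h 0
  have h₁ := congrFun h 1
  have h₂ := congrFun h 2
  have h₃ := congrFun h 3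
  have h₄ := congrFun h 4
  simp [negCoeffs] at h₀ h₁ h₂ h₃ h₄
  funext i
  fin_cases i <;> simp <;> omega

lemma dilateCoeffs_eq_union (t : ℕ) :
    dilateCoeffs t =
      natCoeffs '' {v | ∑ i, v i = t} ∪ negCoeffs '' {v | ∑ i, v i + 2 = t} := by
  ext w
  simp only [dilateCoeffs, Fin.sum_univ_five, Set.mem_union, Set.mem_image, Set.mem_ofPred_eq]
  constructor
  · intro h
    by_cases hw : 0 ≤ w 3 ∧ 0 ≤ w 4
    · refine .inl ⟨fun i ↦ (w i).toNat, ?_, ?_⟩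
      · beta_reduce
        omega
      · funext i
        fin_cases i <;> simp [natCoeffs] <;> omega
    · obtain ⟨k, hk⟩ : ∃ k : ℤ, k = -min (w 3) (w 4) := ⟨_, rfl⟩
      refine .inr ⟨![(w 0 - 2 * k).toNat, (w 1 - k).toNat, (w 2 - k).toNat,
        (w 3 - 1 + 2 * k).toNat, (w 4 - 1 + 2 * k).toNat], ?_, ?_⟩
      · simp
        omega
      · funext i
        fin_cases i <;> simp [negCoeffs] <;> omega
  · rintro (⟨v, hv, rfl⟩ | ⟨v, hv, rfl⟩)
    · simp only [natCoeffs]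
      omega
    · simp [negCoeffs]
      omega

lemma disjoint_range_natCoeffs_negCoeffs :
    Disjoint (Set.range natCoeffs) (Set.range negCoeffs) := by
  rw [Set.disjoint_left]
  rintro _ ⟨v, rfl⟩ ⟨u, h⟩
  have h₃ := congrFun h 3
  have h₄ := congrFun h 4
  simp [natCoeffs, negCoeffs] at h₃ h₄
  omega

lemma ncard_dilateCoeffs (t : ℕ) :
    (dilateCoeffs t).ncard = Nat.choose (t + 4) 4 + Nat.choose (t + 2) 4 := by
  have hfin (n : ℕ) : {v : Fin 5 → ℕ | ∑ i, v i = n}.Finite :=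
    Set.finite_of_ncard_pos (by simp [ncard_nat_tuples_sum_eq, Nat.multichoose_eq, Nat.choose_pos])
  have hcard (n : ℕ) : {v : Fin 5 → ℕ | ∑ i, v i = n}.ncard = Nat.choose (n + 4) 4 := by
    rw [ncard_nat_tuples_sum_eq, Nat.multichoose_eq, show 5 + n - 1 = n + 4 by omega,
      Nat.choose_symm_add]
  have hshift : {v : Fin 5 → ℕ | ∑ i, v i + 2 = t}.Finite ∧
      {v : Fin 5 → ℕ | ∑ i, v i + 2 = t}.ncard = Nat.choose (t + 2) 4 := by
    rcases t with _ | _ | s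
    · simp [Nat.choose]
    · simp [Nat.choose]
    · simpa using ⟨hfin s, hcard s⟩
  rw [dilateCoeffs_eq_union, Set.ncard_union_eq
    (disjoint_range_natCoeffs_negCoeffs.mono (Set.image_subset_range _ _)
      (Set.image_subset_range _ _)) ((hfin t).image _) (hshift.1.image _),
    Set.ncard_image_of_injective _ natCoeffs_injective,
    Set.ncard_image_of_injective _ negCoeffs_injective, hcard, hshift.2]

/-- The Ehrhart counting function of `B_3^2`:
`L(B_3^2; t) = (1/12)t⁴ + (1/2)t³ + (17/12)t² + 2t + 1 = 2·C(t+3,4) + C(t+2,2)`. -/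
theorem ehrhart_B32 (t : ℕ) (ht : 1 ≤ t) :
    (({Z : Matrix (Fin 3) (Fin 3) ℝ | IsIntegerMatrix Z ∧
        ∃ X, InRestrictedBirkhoff 3 2 X ∧ Z = (t : ℝ) • X}.ncard : ℝ) =
      (1 / 12 : ℝ) * t ^ 4 + (1 / 2) * t ^ 3 + (17 / 12) * t ^ 2 + 2 * t + 1) ∧
    {Z : Matrix (Fin 3) (Fin 3) ℝ | IsIntegerMatrix Z ∧
        ∃ X, InRestrictedBirkhoff 3 2 X ∧ Z = (t : ℝ) • X}.ncard =
      2 * Nat.choose (t + 3) 4 + Nat.choose (t + 2) 2 := by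
  rw [dilate_eq_image ht, Set.ncard_image_of_injective _ permCombination_injective,
    ncard_dilateCoeffs]
  constructor
  · simp only [Nat.cast_add, Nat.cast_choose_eq_descPochhammer_div]
    simp [descPochhammer_succ_right, Nat.factorial]
    ring
  · simp only [Nat.choose_succ_succ' (t + 3) 3, Nat.choose_succ_succ' (t + 2) 3,
      Nat.choose_succ_succ' (t + 2) 2]
    ring
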